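/- arXiv:1710.04107 — 2 statements merged into one kernel-verified Lean document; each statement's English description precedes it below -/
import Mathlib

section
/- Let w₁,…,w_k and v₁,…,v_m (k, m ≥ 1) be ⊕-indecomposable permutations, and set W = w₁⊕⋯⊕w_k and V = v₁⊕⋯⊕v_m. Then W is involved in V if and only if: (i) there exists an index i with w₁ involved in v_i, and (ii) letting i₀ be the least such index and j₀ the largest j ∈ {1,…,k} such that w₁⊕⋯⊕w_j is involved in v_{i₀} (such j₀ exists and the set of such j is an initial segment), the permutation w_{j₀+1}⊕⋯⊕w_k is involved in v_{i₀+1}⊕⋯⊕v_m (an empty direct sum being involved in every permutation). -/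
/-- `l` is the one-line notation of a permutation of `{1, …, l.length}`. -/
def IsPermList (l : List ℕ) : Prop :=
  l.Perm ((List.range l.length).map (· + 1))

/-- `Involves σ τ` means the permutation (in one-line notation) `σ` is involved in `τ`
(written σ ≼ τ): there is a strictly increasing map of positions matching relative order. -/
def Involves (σ τ : List ℕ) : Prop :=
  ∃ f : Fin σ.length → Fin τ.length, StrictMono f ∧
    ∀ i j : Fin σ.length, σ.get i < σ.get j ↔ τ.get (f i) < τ.get (f j)

/-- Direct sum `σ ⊕ τ` of permutations in one-line notation. -/
def dsum (σ τ : List ℕ) : List ℕ := σ ++ τ.map (· + σ.length)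

/-- Direct sum of a list of permutations. -/
def sumList (L : List (List ℕ)) : List ℕ := L.foldr dsum []

/-- A permutation is `⊕`-indecomposable if it is nonempty and is not the direct sum
of two nonempty permutations. -/
def IsIndecomposable (w : List ℕ) : Prop :=
  IsPermList w ∧ w ≠ [] ∧
    ¬ ∃ u v : List ℕ, u ≠ [] ∧ v ≠ [] ∧ IsPermList u ∧ IsPermList v ∧ w = dsum u v

theorem isPermList_iff {l : List ℕ} :
    IsPermList l ↔ l.Nodup ∧ ∀ z ∈ l, 1 ≤ z ∧ z ≤ l.length := by
  have hn : ((List.range l.length).map (· + 1)).Nodup :=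
    List.nodup_range.map (add_left_injective 1)
  constructor
  · intro h
    refine ⟨h.nodup_iff.mpr hn, fun z hz => ?_⟩
    have := h.mem_iff.mp hz
    simp only [List.mem_map, List.mem_range] at this
    omega
  · rintro ⟨hd, hb⟩
    have hs : l.Subperm ((List.range l.length).map (· + 1)) := by
      refine hd.subperm fun z hz => ?_
      have := hb z hz
      simp only [List.mem_map, List.mem_range]
      exact ⟨z - 1, by omega, by omega⟩
    exact hs.perm_of_length_le (by simp)

theorem isPermList_nil : IsPermList [] := by simp [isPermList_iff]

theorem isPermList_dsum {σ τ : List ℕ} (hσ : IsPermList σ) (hτ : IsPermList τ) :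
    IsPermList (dsum σ τ) := by
  rw [isPermList_iff] at *
  constructor
  · refine hσ.1.append (hτ.1.map (add_left_injective _)) fun z hz hz' => ?_
    obtain ⟨t, ht, rfl⟩ := List.mem_map.mp hz'
    have := hσ.2 _ hz
    have := hτ.2 t ht
    omega
  · intro z hz
    simp only [dsum, List.mem_append, List.mem_map, List.length_append,
      List.length_map] at hz ⊢
    rcases hz with hz | ⟨t, ht, rfl⟩
    · have := hσ.2 z hz
      omega
    · have := hτ.2 t ht
      omega

theorem isPermList_sumList {ws : List (List ℕ)} (h : ∀ w ∈ ws, IsPermList w) :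
    IsPermList (sumList ws) := by
  induction ws with
  | nil => exact isPermList_nil
  | cons w ws ih =>
    exact isPermList_dsum (h w (by simp)) (ih fun u hu => h u (by simp [hu]))

/-- A cut of a permutation into a lower prefix and an upper suffix is a direct sum. -/
theorem IsPermList.exists_eq_dsum {x y : List ℕ} (h : IsPermList (x ++ y))
    (hlt : ∀ a ∈ x, ∀ b ∈ y, a < b) :
    IsPermList x ∧ ∃ y', IsPermList y' ∧ x ++ y = dsum x y' := by
  have hp := isPermList_iff.mp h
  have hxd : x.Nodup := hp.1.of_append_left
  have hyd : y.Nodup := hp.1.of_append_right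
  have hmem : ∀ z, 1 ≤ z → z ≤ (x ++ y).length → z ∈ x ++ y := by
    intro z h1 h2
    rw [List.Perm.mem_iff h]
    simp only [List.mem_map, List.mem_range]
    exact ⟨z - 1, by omega, by omega⟩
  have hxb : ∀ z ∈ x, 1 ≤ z ∧ z ≤ x.length := by
    intro z hz
    have hz' := hp.2 z (by simp [hz])
    refine ⟨hz'.1, ?_⟩
    have hsub : Finset.Icc 1 z ⊆ x.toFinset := by
      intro t ht
      rw [Finset.mem_Icc] at ht
      rcases List.mem_append.mp (hmem t ht.1 (ht.2.trans hz'.2)) with h' | h'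
      · simpa using h'
      · have := hlt z hz t h'
        omega
    have := Finset.card_le_card hsub
    rw [List.toFinset_card_of_nodup hxd] at this
    simpa using this
  have hx : IsPermList x := isPermList_iff.mpr ⟨hxd, hxb⟩
  have hyb : ∀ z ∈ y, x.length < z ∧ z ≤ x.length + y.length := by
    intro z hz
    have hz' := hp.2 z (by simp [hz])
    refine ⟨?_, by simpa using hz'.2⟩
    by_contra! hle
    have hzx : z ∈ x := by
      rw [List.Perm.mem_iff hx]
      simp only [List.mem_map, List.mem_range]
      exact ⟨z - 1, by omega, by omega⟩
    exact lt_irrefl z (hlt z hzx z hz)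
  refine ⟨hx, y.map (· - x.length), isPermList_iff.mpr ⟨?_, ?_⟩, ?_⟩
  · refine hyd.map_on fun a ha b hb hab => ?_
    have := hyb a ha
    have := hyb b hb
    omega
  · intro z hz
    obtain ⟨t, ht, rfl⟩ := List.mem_map.mp hz
    have := hyb t ht
    simp only [List.length_map]
    omega
  · rw [dsum, List.map_map]
    congr 1
    symm
    refine (List.map_congr_left fun z hz => ?_).trans (List.map_id y)
    have := hyb z hz
    simp only [Function.comp_apply, id_eq]
    omega

theorem involves_iff_exists_strictMonoOn {σ τ : List ℕ} :
    Involves σ τ ↔ ∃ g : ℕ → ℕ, StrictMonoOn g {x | x ∈ σ} ∧ (σ.map g).Sublist τ := by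
  constructor
  · rintro ⟨f, hf, h⟩
    have hex : ∀ x : ℕ, ∃ y : ℕ, ∀ i, σ.get i = x → τ.get (f i) = y := by
      intro x
      by_cases hx : ∃ i, σ.get i = x
      · obtain ⟨i, rfl⟩ := hx
        refine ⟨τ.get (f i), fun j hj => ?_⟩
        have h1 := h i j
        have h2 := h j i
        omega
      · exact ⟨0, fun i hi => (hx ⟨i, hi⟩).elim⟩
    choose g hg using hex
    refine ⟨g, ?_, ?_⟩
    · intro a ha b hb hab
      obtain ⟨i, rfl⟩ := List.mem_iff_get.mp ha
      obtain ⟨j, rfl⟩ := List.mem_iff_get.mp hb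
      rw [← hg _ i rfl, ← hg _ j rfl]
      exact (h i j).mp hab
    · rw [List.sublist_iff_exists_fin_orderEmbedding_get_eq]
      refine ⟨OrderEmbedding.ofStrictMono (fun i => f (i.cast (by simp))) ?_, ?_⟩
      · intro i j hij
        exact hf hij
      · intro i
        have := hg _ (i.cast (by simp)) rfl
        simp only [List.get_eq_getElem, List.getElem_map]
        exact this.symm
  · rintro ⟨g, hg, h⟩
    obtain ⟨f, hf⟩ := List.sublist_iff_exists_fin_orderEmbedding_get_eq.mp h
    refine ⟨fun i => f (i.cast (by simp)), fun i j hij => ?_, fun i j => ?_⟩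
    · exact f.strictMono hij
    · rw [← hf, ← hf]
      simp only [List.get_eq_getElem, List.getElem_map]
      exact (hg.lt_iff_lt (List.getElem_mem _) (List.getElem_mem _)).symm

theorem Involves.trans {ρ σ τ : List ℕ} (h₁ : Involves ρ σ) (h₂ : Involves σ τ) :
    Involves ρ τ := by
  obtain ⟨f, hf, hf'⟩ := h₁
  obtain ⟨g, hg, hg'⟩ := h₂
  exact ⟨g ∘ f, hg.comp hf, fun i j => (hf' i j).trans (hg' _ _)⟩

theorem Involves.dsum_left (σ τ : List ℕ) : Involves σ (dsum σ τ) :=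
  involves_iff_exists_strictMonoOn.mpr
    ⟨id, strictMono_id.strictMonoOn _, by simp [dsum]⟩

theorem Involves.dsum_right (σ τ : List ℕ) : Involves τ (dsum σ τ) :=
  involves_iff_exists_strictMonoOn.mpr
    ⟨(· + σ.length), fun _ _ _ _ h => Nat.add_lt_add_right h _, List.sublist_append_right _ _⟩

theorem involves_dsum_dsum {σ σ' τ τ' : List ℕ} (hσ : IsPermList σ) (hσ' : IsPermList σ')
    (hτ : IsPermList τ) (hτ' : IsPermList τ') (h₁ : Involves σ σ') (h₂ : Involves τ τ') :
    Involves (dsum σ τ) (dsum σ' τ') := by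
  rw [involves_iff_exists_strictMonoOn] at *
  rw [isPermList_iff] at *
  obtain ⟨g, hg, hgs⟩ := h₁
  obtain ⟨k, hk, hks⟩ := h₂
  have hgb : ∀ a ∈ σ, g a ≤ σ'.length := fun a ha =>
    (hσ'.2 _ (hgs.subset (List.mem_map_of_mem ha))).2
  have hkb : ∀ a ∈ τ, 1 ≤ k a := fun a ha =>
    (hτ'.2 _ (hks.subset (List.mem_map_of_mem ha))).1
  let G : ℕ → ℕ := fun x => if x ≤ σ.length then g x else k (x - σ.length) + σ'.length
  have hG₁ : ∀ a ∈ σ, G a = g a := fun a ha => if_pos (hσ.2 a ha).2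
  have hG₂ : ∀ a ∈ τ, G (a + σ.length) = k a + σ'.length := by
    intro a ha
    have := hτ.2 a ha
    simp only [G]
    rw [if_neg (by omega), Nat.add_sub_cancel]
  refine ⟨G, ?_, ?_⟩
  · intro a ha b hb hab
    simp only [dsum, Set.mem_ofPred_eq, List.mem_append, List.mem_map] at ha hb
    rcases ha with ha | ⟨a, ha, rfl⟩ <;> rcases hb with hb | ⟨b, hb, rfl⟩
    · rw [hG₁ a ha, hG₁ b hb]
      exact hg ha hb hab
    · rw [hG₁ a ha, hG₂ b hb]
      have := hgb a ha
      have := hkb b hb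
      omega
    · have := hσ.2 b hb
      have := hτ.2 a ha
      omega
    · rw [hG₂ a ha, hG₂ b hb]
      exact Nat.add_lt_add_right (hk ha hb (by omega)) _
  · rw [dsum, dsum, List.map_append, List.map_congr_left hG₁, List.map_map]
    refine hgs.append ?_
    rw [List.map_congr_left (f := G ∘ (· + σ.length)) (g := (· + σ'.length) ∘ k)
      fun a ha => hG₂ a ha, ← List.map_map]
    exact hks.map _

theorem dsum_assoc (ρ σ τ : List ℕ) : dsum (dsum ρ σ) τ = dsum ρ (dsum σ τ) := by
  simp [dsum, Function.comp_def, Nat.add_assoc, Nat.add_comm ρ.length]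

theorem sumList_append (L M : List (List ℕ)) :
    sumList (L ++ M) = dsum (sumList L) (sumList M) := by
  induction L with
  | nil => simp [sumList, dsum]
  | cons w L ih =>
    change dsum w (sumList (L ++ M)) = dsum (dsum w (sumList L)) (sumList M)
    rw [ih, dsum_assoc]

theorem dsum_take_drop (ws : List (List ℕ)) (j : ℕ) :
    dsum (sumList (ws.take j)) (sumList (ws.drop j)) = sumList ws := by
  rw [← sumList_append, List.take_append_drop]

theorem involves_sumList_take (ws : List (List ℕ)) {i j : ℕ} (h : i ≤ j) :
    Involves (sumList (ws.take i)) (sumList (ws.take j)) := by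
  rw [← dsum_take_drop (ws.take j) i, List.take_take, min_eq_left h]
  exact Involves.dsum_left _ _

theorem involves_sumList_drop (ws : List (List ℕ)) {i j : ℕ} (h : i ≤ j) :
    Involves (sumList (ws.drop j)) (sumList (ws.drop i)) := by
  rw [← dsum_take_drop (ws.drop i) (j - i), List.drop_drop, Nat.add_sub_cancel' h]
  exact Involves.dsum_right _ _

/-- A cut of a direct sum of indecomposables falls between two summands. -/
theorem exists_eq_sumList_take_of_append {ws : List (List ℕ)}
    (hw : ∀ w ∈ ws, IsIndecomposable w) {x y : List ℕ} (he : sumList ws = x ++ y)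
    (hlt : ∀ a ∈ x, ∀ b ∈ y, a < b) :
    ∃ j ≤ ws.length, x = sumList (ws.take j) ∧
      y = (sumList (ws.drop j)).map (· + x.length) := by
  induction ws generalizing x y with
  | nil =>
    obtain ⟨rfl, rfl⟩ := List.append_eq_nil_iff.mp he.symm
    exact ⟨0, by simp [sumList]⟩
  | cons w ws ih =>
    rcases eq_or_ne x [] with rfl | hx
    · exact ⟨0, by simp, by simp [sumList], by simpa using he.symm⟩
    have he' : w ++ (sumList ws).map (· + w.length) = x ++ y := he
    obtain ⟨hwp, -, hwi⟩ := hw w (by simp)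
    rcases List.append_eq_append_iff.mp he' with ⟨x', rfl, hy⟩ | ⟨y', rfl, rfl⟩
    · obtain ⟨x'', y'', hs, rfl, rfl⟩ := List.map_eq_append_iff.mp hy
      obtain ⟨j, hj, rfl, hy''⟩ := ih (fun u hu => hw u (by simp [hu])) hs (by
        intro a ha b hb
        have := hlt (a + w.length) (by simp [ha]) (b + w.length) (by simp [hb])
        omega)
      refine ⟨j + 1, by simpa using hj, rfl, ?_⟩
      rw [hy'']
      simp [Function.comp_def, Nat.add_assoc, Nat.add_comm w.length]
    · rcases eq_or_ne y' [] with rfl | hy'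
      · exact ⟨1, by simp, by simp [sumList, dsum], by simp⟩
      · obtain ⟨h1, z, h2, h3⟩ := hwp.exists_eq_dsum fun a ha b hb => hlt a ha b (by simp [hb])
        refine (hwi ⟨x, z, hx, ?_, h1, h2, h3⟩).elim
        rintro rfl
        simp [dsum, hy'] at h3

/-- An involvement of a direct sum of indecomposables in `a ⊕ b` splits between two summands. -/
theorem Involves.exists_take_drop {ws : List (List ℕ)} (hw : ∀ w ∈ ws, IsIndecomposable w)
    {a b : List ℕ} (ha : IsPermList a) (hb : IsPermList b)
    (h : Involves (sumList ws) (dsum a b)) :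
    ∃ j ≤ ws.length, Involves (sumList (ws.take j)) a ∧ Involves (sumList (ws.drop j)) b := by
  obtain ⟨g, hg, hs⟩ := involves_iff_exists_strictMonoOn.mp h
  obtain ⟨l₁, l₂, hl, hl₁, hl₂⟩ := List.sublist_append_iff.mp hs
  obtain ⟨x, y, he, rfl, rfl⟩ := List.map_eq_append_iff.mp hl
  have hxb : ∀ z ∈ x, g z ≤ a.length := fun z hz =>
    ((isPermList_iff.mp ha).2 _ (hl₁.subset (List.mem_map_of_mem hz))).2
  have hyb : ∀ z ∈ y, a.length < g z := by
    intro z hz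
    obtain ⟨t, ht, h'⟩ := List.mem_map.mp (hl₂.subset (List.mem_map_of_mem hz))
    have := ((isPermList_iff.mp hb).2 t ht).1
    omega
  rw [he] at hg
  obtain ⟨j, hj, hx, hy⟩ := exists_eq_sumList_take_of_append hw he (by
    intro s hs t ht
    rw [← hg.lt_iff_lt (by simp [hs]) (by simp [ht])]
    exact (hxb s hs).trans_lt (hyb t ht))
  refine ⟨j, hj, ?_, ?_⟩
  · rw [← hx]
    exact involves_iff_exists_strictMonoOn.mpr
      ⟨g, hg.mono fun z hz => List.mem_append_left _ hz, hl₁⟩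
  · have hmem : ∀ z ∈ sumList (ws.drop j), z + x.length ∈ y := by
      intro z hz
      rw [hy]
      exact List.mem_map_of_mem (f := (· + x.length)) hz
    refine involves_iff_exists_strictMonoOn.mpr
      ⟨fun z => g (z + x.length) - a.length, fun s hs t ht hst => ?_, ?_⟩
    · have h1 := hyb _ (hmem s hs)
      have h2 := hg (List.mem_append_right _ (hmem s hs)) (List.mem_append_right _ (hmem t ht))
        (Nat.add_lt_add_right hst x.length)
      change g (s + x.length) - a.length < g (t + x.length) - a.length
      omega
    · have h1 := hl₂.map (· - a.length)
      rw [hy] at h1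
      simpa [Function.comp_def] using h1

/-- Greedy recognition of involvement for direct sums of `⊕`-indecomposable permutations:
`W = w₁ ⊕ ⋯ ⊕ w_k` is involved in `V = v₁ ⊕ ⋯ ⊕ v_m` iff `w₁` is involved in some `v_i`,
and, taking `i₀` least such and `j₀` greatest with `w₁ ⊕ ⋯ ⊕ w_{j₀}` involved in `v_{i₀}`
(such `j₀` exists and the set of such `j` is an initial segment),
`w_{j₀+1} ⊕ ⋯ ⊕ w_k` is involved in `v_{i₀+1} ⊕ ⋯ ⊕ v_m`. -/
theorem greedy_involvement (ws vs : List (List ℕ)) (hws : ws ≠ []) (hvs : vs ≠ [])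
    (hw : ∀ w ∈ ws, IsIndecomposable w) (hv : ∀ v ∈ vs, IsIndecomposable v) :
    Involves (sumList ws) (sumList vs) ↔
      ∃ i₀ : Fin vs.length,
        Involves (ws.head hws) (vs.get i₀) ∧
        (∀ i : Fin vs.length, i < i₀ → ¬ Involves (ws.head hws) (vs.get i)) ∧
        ∃ j₀ : ℕ, 1 ≤ j₀ ∧ j₀ ≤ ws.length ∧
          (∀ j, j ≤ j₀ → Involves (sumList (ws.take j)) (vs.get i₀)) ∧
          (∀ j, j ≤ ws.length → Involves (sumList (ws.take j)) (vs.get i₀) → j ≤ j₀) ∧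
          Involves (sumList (ws.drop j₀)) (sumList (vs.drop (i₀.val + 1))) := by
  have hwp : ∀ w ∈ ws, IsPermList w := fun w h => (hw w h).1
  constructor
  · intro h
    clear hvs
    induction vs with
    | nil =>
      obtain ⟨w, ws, rfl⟩ := List.exists_cons_of_ne_nil hws
      obtain ⟨f, -⟩ := h
      have hpos := List.length_pos_iff.mpr (hw w (by simp)).2.1
      exact (f ⟨0, by simp only [sumList, List.foldr_cons, dsum, List.length_append]; omega⟩).elim0
    | cons v vs ih =>
      have hvp : ∀ u ∈ vs, IsPermList u := fun u hu => (hv u (by simp [hu])).1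
      obtain ⟨j, hj, h1, h2⟩ := Involves.exists_take_drop hw (hv v (by simp)).1
        (isPermList_sumList hvp) h
      have htake : sumList (ws.take 1) = ws.head hws := by
        obtain ⟨w, ws, rfl⟩ := List.exists_cons_of_ne_nil hws
        simp [sumList, dsum]
      have hlen := List.length_pos_iff.mpr hws
      by_cases hc : Involves (ws.head hws) v
      · classical
        let P : ℕ → Prop := fun j => Involves (sumList (ws.take j)) v
        have hP : P (Nat.findGreatest P ws.length) :=
          Nat.findGreatest_spec (m := j) hj h1
        refine ⟨⟨0, by simp⟩, hc, fun i hi => absurd hi (Nat.not_lt_zero _),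
          Nat.findGreatest P ws.length, ?_, Nat.findGreatest_le _, ?_, ?_, ?_⟩
        · exact Nat.le_findGreatest hlen (by simpa only [P, htake] using hc)
        · exact fun i hi => (involves_sumList_take ws hi).trans hP
        · exact fun i hi hi' => Nat.le_findGreatest hi hi'
        · exact (involves_sumList_drop ws (Nat.le_findGreatest hj h1)).trans h2
      · have hj0 : j = 0 := by
          by_contra hne
          refine hc ?_
          rw [← htake]
          exact (involves_sumList_take ws (Nat.one_le_iff_ne_zero.mpr hne)).trans h1
        subst hj0
        obtain ⟨i, hi, hmin, hrest⟩ := ih (fun u hu => hv u (by simp [hu])) h2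
        refine ⟨i.succ, hi, fun i' hi' => ?_, hrest⟩
        induction i' using Fin.cases with
        | zero => exact hc
        | succ i' => exact hmin i' (Fin.succ_lt_succ_iff.mp hi')
  · rintro ⟨i, -, -, j, -, -, h1, -, h2⟩
    have hvp : ∀ v ∈ vs, IsPermList v := fun v h => (hv v h).1
    have hd : sumList (vs.drop i) = dsum (vs.get i) (sumList (vs.drop (i + 1))) := by
      rw [List.drop_eq_getElem_cons i.isLt]
      rfl
    have h3 : Involves (sumList ws) (sumList (vs.drop i)) := by
      rw [hd, ← dsum_take_drop ws j]
      exact involves_dsum_dsum (isPermList_sumList fun w h => hwp w (List.mem_of_mem_take h))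
        (hvp _ (List.get_mem _ _)) (isPermList_sumList fun w h => hwp w (List.mem_of_mem_drop h))
        (isPermList_sumList fun v h => hvp v (List.mem_of_mem_drop h)) (h1 j le_rfl) h2
    exact h3.trans (by simpa using involves_sumList_drop vs (Nat.zero_le i))
end

section
/- Let C = Av(312,123) and let π, τ ∈ C be nonempty. Then Av_C(π) and Av_C(τ) are Wilf-equivalent (i.e. for every n the number of permutations of size n in C avoiding π equals the number of permutations of size n in C avoiding τ) if and only if |π| = |τ| and either both or neither of π and τ is strictly decreasing. -/
/-- The strictly decreasing permutation of size `n`, in one-line notation `n, n-1, …, 1`. -/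
def descList (n : ℕ) : List ℕ := (List.range n).map (fun i => n - i)

/-- The value at the (zero-based) position `i` of `(δ_k ⊕ δ_m) ⊖ δ_j`, where `δ` denotes a strictly
decreasing permutation. -/
def blockVal (k m j i : ℕ) : ℕ :=
  if i < k then j + k - i else if i < k + m then j + k + m - (i - k) else k + m + j - i

/-- One-line notation of `(δ_k ⊕ δ_m) ⊖ δ_j`, where `δ` denotes a strictly decreasing
permutation. -/
def blockPerm (k m j : ℕ) : List ℕ := (List.range (k + m + j)).map (blockVal k m j)

/-- The permutations of size `n` in `Av(312, 123)`. -/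
def avClass (n : ℕ) : Set (List ℕ) :=
  {l | l.length = n ∧ IsPermList l ∧ ¬ Involves [3, 1, 2] l ∧ ¬ Involves [1, 2, 3] l}

/-- The members of `Av(312, 123)` of size `n` that involve `π`. -/
def involvingClass (π : List ℕ) (n : ℕ) : Set (List ℕ) := {l ∈ avClass n | Involves π l}

lemma length_blockPerm (k m j : ℕ) : (blockPerm k m j).length = k + m + j := by
  simp [blockPerm]

lemma getElem_blockPerm (k m j i : ℕ) (h : i < (blockPerm k m j).length) :
    (blockPerm k m j)[i] = blockVal k m j i := by
  simp [blockPerm]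

lemma descList_eq_blockPerm (n : ℕ) : descList n = blockPerm 0 n 0 := by
  apply List.ext_getElem
  · simp [descList, blockPerm]
  · intro i h₁ h₂
    simp only [descList, List.length_map, List.length_range] at h₁
    simp [descList, blockPerm, blockVal, h₁]

lemma isPermList_of_nodup {l : List ℕ} (h : l.Nodup) (hl : ∀ x ∈ l, 1 ≤ x ∧ x ≤ l.length) :
    IsPermList l := by
  have hsub : l ⊆ (List.range l.length).map (· + 1) := by
    intro x hx
    have := hl x hx
    simp only [List.mem_map, List.mem_range]
    exact ⟨x - 1, by omega, by omega⟩
  exact (h.subperm hsub).perm_of_length_le (by simp)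

lemma isPermList_blockPerm (k m j : ℕ) : IsPermList (blockPerm k m j) := by
  apply isPermList_of_nodup
  · refine List.Nodup.map_on ?_ List.nodup_range
    intro x hx y hy h
    simp only [List.mem_range] at hx hy
    unfold blockVal at h
    split_ifs at h <;> omega
  · intro x hx
    rw [length_blockPerm]
    simp only [blockPerm, List.mem_map, List.mem_range] at hx
    obtain ⟨i, hi, rfl⟩ := hx
    unfold blockVal
    split_ifs <;> omega

lemma not_involves_312_blockPerm (k m j : ℕ) : ¬ Involves [3, 1, 2] (blockPerm k m j) := by
  rintro ⟨f, hf, h⟩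
  have h01 : (f 0).val < (f 1).val := hf (by decide)
  have h12 : (f 1).val < (f 2).val := hf (by decide)
  have h₁ := (h 1 2).1 (by decide)
  have h₂ := (h 2 0).1 (by decide)
  have := (f 2).isLt
  simp only [List.get_eq_getElem, getElem_blockPerm, blockVal] at h₁ h₂
  simp only [length_blockPerm] at this
  split_ifs at h₁ h₂ <;> omega

lemma not_involves_123_blockPerm (k m j : ℕ) : ¬ Involves [1, 2, 3] (blockPerm k m j) := by
  rintro ⟨f, hf, h⟩
  have h01 : (f 0).val < (f 1).val := hf (by decide)
  have h12 : (f 1).val < (f 2).val := hf (by decide)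
  have h₁ := (h 0 1).1 (by decide)
  have h₂ := (h 1 2).1 (by decide)
  have := (f 2).isLt
  simp only [List.get_eq_getElem, getElem_blockPerm, blockVal] at h₁ h₂
  simp only [length_blockPerm] at this
  split_ifs at h₁ h₂ <;> omega

lemma blockPerm_mem_avClass (k m j : ℕ) : blockPerm k m j ∈ avClass (k + m + j) :=
  ⟨length_blockPerm k m j, isPermList_blockPerm k m j, not_involves_312_blockPerm k m j,
    not_involves_123_blockPerm k m j⟩

lemma strictMono_fin_add_le {a b : ℕ} {f : Fin a → Fin b} (hf : StrictMono f) (i d : ℕ)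
    (h : i + d < a) : (f ⟨i, by omega⟩).val + d ≤ (f ⟨i + d, h⟩).val := by
  induction d with
  | zero => simp
  | succ d ih =>
    have h₁ := ih (by omega)
    have h₂ : (f ⟨i + d, by omega⟩).val < (f ⟨i + (d + 1), h⟩).val :=
      hf (Fin.mk_lt_mk.2 (by omega))
    omega

lemma involves_blockPerm_iff {k m j K M J : ℕ} (hk : 1 ≤ k) (hm : 1 ≤ m) :
    Involves (blockPerm k m j) (blockPerm K M J) ↔ k ≤ K ∧ m ≤ M ∧ j ≤ J := by
  constructor
  · rintro ⟨f, hf, h⟩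
    have len := length_blockPerm k m j
    have len' := length_blockPerm K M J
    have lt_of (a b : ℕ) (ha : a < k + m + j) (hb : b < k + m + j) (hab : a < b) :
        (f ⟨a, by omega⟩).val < (f ⟨b, by omega⟩).val := hf (Fin.mk_lt_mk.2 hab)
    have ord (a b : ℕ) (ha : a < k + m + j) (hb : b < k + m + j) :
        blockVal k m j a < blockVal k m j b ↔
          blockVal K M J (f ⟨a, by omega⟩) < blockVal K M J (f ⟨b, by omega⟩) := by
      simpa only [List.get_eq_getElem, getElem_blockPerm] using
        h ⟨a, by omega⟩ ⟨b, by omega⟩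
    have asc (a b : ℕ) (ha : a < k) (hb : k ≤ b) (hb' : b < k + m) :
        (f ⟨a, by omega⟩).val < K ∧ K ≤ (f ⟨b, by omega⟩).val ∧
          (f ⟨b, by omega⟩).val < K + M := by
      have h₁ := lt_of a b (by omega) (by omega) (by omega)
      have h₂ := (ord a b (by omega) (by omega)).1 (by
        unfold blockVal
        split_ifs <;> omega)
      have := (f ⟨b, by omega⟩).isLt
      unfold blockVal at h₂
      split_ifs at h₂ <;> omega
    have hlow (c : ℕ) (hc : k + m ≤ c) (hc' : c < k + m + j) :
        K + M ≤ (f ⟨c, by omega⟩).val := by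
      have h₀ := asc 0 k (by omega) (by omega) (by omega)
      have h₁ := lt_of k c (by omega) (by omega) (by omega)
      have h₂ := (ord c 0 (by omega) (by omega)).1 (by
        unfold blockVal
        split_ifs <;> omega)
      have := (f ⟨c, by omega⟩).isLt
      unfold blockVal at h₂
      split_ifs at h₂ <;> omega
    refine ⟨?_, ?_, ?_⟩
    · have h₁ := strictMono_fin_add_le hf 0 (k - 1) (by omega)
      have h₂ := asc (0 + (k - 1)) k (by omega) (by omega) (by omega)
      omega
    · have h₁ := strictMono_fin_add_le hf k (m - 1) (by omega)
      have h₂ := asc 0 k (by omega) (by omega) (by omega)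
      have h₃ := asc 0 (k + (m - 1)) (by omega) (by omega) (by omega)
      omega
    · rcases Nat.eq_zero_or_pos j with rfl | hj
      · omega
      · have h₁ := strictMono_fin_add_le hf (k + m) (j - 1) (by omega)
        have h₂ := hlow (k + m) le_rfl (by omega)
        have := (f ⟨k + m + (j - 1), by omega⟩).isLt
        omega
  · rintro ⟨h₁, h₂, h₃⟩
    have hlt (i : Fin (blockPerm k m j).length) : i.val < k + m + j :=
      i.isLt.trans_eq (length_blockPerm k m j)
    refine ⟨fun i => ⟨if i.val < k then i else if i.val < k + m then i - k + K
      else i - (k + m) + (K + M), ?_⟩, ?_, ?_⟩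
    · have := hlt i
      refine lt_of_lt_of_eq ?_ (length_blockPerm K M J).symm
      split_ifs <;> omega
    · intro a b hab
      have hab' : a.val < b.val := hab
      rw [Fin.mk_lt_mk]
      split_ifs <;> omega
    · intro a b
      have := hlt a
      have := hlt b
      simp only [List.get_eq_getElem, getElem_blockPerm]
      unfold blockVal
      split_ifs <;> omega

lemma involves_descList_blockPerm {s K M J : ℕ} (h : 2 * s ≤ K + M + J) :
    Involves (descList s) (blockPerm K M J) := by
  rw [descList_eq_blockPerm]
  have hlt (i : Fin (blockPerm 0 s 0).length) : i.val < s := by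
    have := i.isLt.trans_eq (length_blockPerm 0 s 0)
    omega
  have aux (t : ℕ) (ht : t + s ≤ K ∨ K ≤ t ∧ t + s ≤ K + M + J) :
      Involves (blockPerm 0 s 0) (blockPerm K M J) := by
    refine ⟨fun i => ⟨t + i, ?_⟩, ?_, ?_⟩
    · have := hlt i
      refine lt_of_lt_of_eq ?_ (length_blockPerm K M J).symm
      omega
    · intro a b hab
      have hab' : a.val < b.val := hab
      rw [Fin.mk_lt_mk]
      omega
    · intro a b
      have := hlt a
      have := hlt b
      simp only [List.get_eq_getElem, getElem_blockPerm]
      unfold blockVal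
      split_ifs <;> omega
  by_cases hs : s ≤ K
  · exact aux 0 (by omega)
  · exact aux K (by omega)

lemma involves_refl (l : List ℕ) : Involves l l := ⟨id, strictMono_id, fun _ _ => Iff.rfl⟩

lemma Involves.length_le {σ τ : List ℕ} (h : Involves σ τ) : σ.length ≤ τ.length := by
  obtain ⟨f, hf, -⟩ := h
  simpa using Fintype.card_le_of_injective f hf.injective

lemma involves_of_sublist {σ τ τ' : List ℕ} (hs : τ'.Sublist τ) (h : Involves σ τ') :
    Involves σ τ := by
  obtain ⟨g, hg⟩ := List.sublist_iff_exists_fin_orderEmbedding_get_eq.1 hs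
  obtain ⟨f, hf, h⟩ := h
  refine ⟨g ∘ f, g.strictMono.comp hf, fun i j => ?_⟩
  simp only [Function.comp_apply, ← hg]
  exact h i j

lemma involves_312_of_sublist {a b c : ℕ} {l : List ℕ} (hs : [c, a, b].Sublist l) (hab : a < b)
    (hbc : b < c) : Involves [3, 1, 2] l := by
  refine involves_of_sublist hs ⟨id, strictMono_id, fun i j => ?_⟩
  fin_cases i <;> fin_cases j <;> simp <;> omega

lemma involves_123_of_sublist {a b c : ℕ} {l : List ℕ} (hs : [a, b, c].Sublist l) (hab : a < b)
    (hbc : b < c) : Involves [1, 2, 3] l := by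
  refine involves_of_sublist hs ⟨id, strictMono_id, fun i j => ?_⟩
  fin_cases i <;> fin_cases j <;> simp <;> omega

lemma IsPermList.nodup {l : List ℕ} (h : IsPermList l) : l.Nodup :=
  h.nodup_iff.2 (List.nodup_range.map fun _ _ h => Nat.succ_injective h)

lemma IsPermList.le_length {l : List ℕ} (h : IsPermList l) {x : ℕ} (hx : x ∈ l) :
    x ≤ l.length := by
  have := h.mem_iff.1 hx
  simp only [List.mem_map, List.mem_range] at this
  omega

lemma IsPermList.perm {l l' : List ℕ} (h : IsPermList l) (h' : IsPermList l')
    (hl : l.length = l'.length) : l.Perm l' := by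
  unfold IsPermList at h h'
  rw [hl] at h
  exact h.trans h'.symm

lemma isPermList_descList (n : ℕ) : IsPermList (descList n) := by
  rw [descList_eq_blockPerm]
  exact isPermList_blockPerm 0 n 0

lemma length_descList (n : ℕ) : (descList n).length = n := by
  simp [descList]

lemma pairwise_descList (n : ℕ) : (descList n).Pairwise (· > ·) := by
  rw [descList, List.pairwise_map]
  refine List.Pairwise.imp_of_mem ?_ List.pairwise_lt_range
  intro a b ha hb hab
  simp only [List.mem_range] at ha hb
  omega

lemma blockPerm_eq_of_append_eq_descList {A X Y : List ℕ} {n : ℕ}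
    (h : X ++ A ++ Y = descList n) :
    A ++ X ++ Y = blockPerm A.length X.length Y.length := by
  have hn : X.length + A.length + Y.length = n := by
    simpa [length_descList, add_assoc] using congrArg List.length h
  have key (i : ℕ) (hi : i < (X ++ A ++ Y).length) : (X ++ A ++ Y)[i] = n - i := by
    simp [h, descList]
  apply List.ext_getElem
  · simp [length_blockPerm, add_assoc]
  · intro i h₁ h₂
    rw [getElem_blockPerm]
    rw [length_blockPerm] at h₂
    unfold blockVal
    split_ifs with hA hX
    · have := key (X.length + i) (by simp; omega)
      grind
    · have := key (i - A.length) (by simp; omega)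
      grind
    · have := key i (by simp; omega)
      grind

/-- Every member of `Av(312, 123)` has the form `(δ_k ⊕ δ_m) ⊖ δ_j`. -/
lemma exists_eq_blockPerm {n : ℕ} {l : List ℕ} (h : l ∈ avClass n) :
    ∃ k m j, l = blockPerm k m j := by
  obtain ⟨-, hp, h312, h123⟩ := h
  rcases eq_or_ne l [] with rfl | hne
  · exact ⟨0, 0, 0, rfl⟩
  have hpos := List.length_pos_iff.2 hne
  have hmem : l.length ∈ l := hp.mem_iff.2 (by
    simp only [List.mem_map, List.mem_range]
    exact ⟨l.length - 1, by omega, by omega⟩)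
  have hle := fun x => hp.le_length (x := x)
  have hnd := hp.nodup
  generalize hN : l.length = N at hmem hle
  obtain ⟨A, B, rfl⟩ := List.append_of_mem hmem
  obtain ⟨-, hndB, hdisj⟩ := List.nodup_append.1 hnd
  have hA : ∀ a ∈ A, a < N := fun a ha =>
    lt_of_le_of_ne (hle a (by simp [ha])) (hdisj a ha N (by simp))
  have hB : ∀ b ∈ B, b < N := fun b hb =>
    lt_of_le_of_ne (hle b (by simp [hb])) fun h => (List.nodup_cons.1 hndB).1 (h ▸ hb)
  have hAB : ∀ a ∈ A, ∀ b ∈ B, a ≠ b := fun a ha b hb => hdisj a ha b (by simp [hb])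
  have hAdesc : A.Pairwise (· > ·) := by
    rw [List.pairwise_iff_forall_sublist]
    intro a b hs
    have hne : a ≠ b := by
      have := (hnd.sublist (List.sublist_append_left A _)).sublist hs
      simpa using this
    by_contra hab
    exact h123 (involves_123_of_sublist (hs.append (List.singleton_sublist.2 (by simp) :
      [N].Sublist (N :: B))) (by omega) (hA b (hs.subset (by simp))))
  have hBdesc : B.Pairwise (· > ·) := by
    rw [List.pairwise_iff_forall_sublist]
    intro a b hs
    have hne : a ≠ b := by
      have := (hnd.sublist ((List.sublist_cons_self N B).trans
        (List.sublist_append_right A _))).sublist hs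
      simpa using this
    by_contra hab
    exact h312 (involves_312_of_sublist ((hs.cons_cons N).trans
      (List.sublist_append_right A _)) (by omega) (hB b (hs.subset (by simp))))
  have hcross : ∀ x ∈ A, ∀ y ∈ A, ∀ b ∈ B, ¬ (y < b ∧ b < x ∨ x < b ∧ b < y) := by
    have hpw : A.Pairwise fun x y => ∀ b ∈ B, ¬ (y < b ∧ b < x ∨ x < b ∧ b < y) := by
      rw [List.pairwise_iff_forall_sublist] at hAdesc ⊢
      intro x y hs b hb
      have := hAdesc hs
      rintro (⟨h₁, h₂⟩ | ⟨h₁, h₂⟩)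
      · exact h312 (involves_312_of_sublist (hs.append (List.singleton_sublist.2 (by simp [hb]) :
          [b].Sublist (N :: B))) h₁ h₂)
      · omega
    intro x hx y hy
    have : Std.Symm fun x y => ∀ b ∈ B, ¬ (y < b ∧ b < x ∨ x < b ∧ b < y) :=
      ⟨fun x y h b hb => or_comm.not.1 (h b hb)⟩
    exact List.Pairwise.forall_of_forall (fun x _ b _ => by omega) hpw hx hy
  set B₁ := B.filter fun b => ∀ a ∈ A, a < b with hB₁
  set B₂ := B.filter fun b => ¬ ∀ a ∈ A, a < b with hB₂
  have hperm : (B₁ ++ B₂).Perm B := by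
    simpa only [hB₁, hB₂, decide_not] using List.filter_append_perm (fun b => decide (∀ a ∈ A, a < b)) B
  have hm₁ : ∀ b ∈ B₁, b ∈ B ∧ ∀ a ∈ A, a < b := by
    intro b hb
    simpa [hB₁] using hb
  have hm₂ : ∀ b ∈ B₂, b ∈ B ∧ ∃ a ∈ A, b < a := by
    intro b hb
    simp only [hB₂, List.mem_filter, decide_eq_true_eq] at hb
    push Not at hb
    obtain ⟨hb, a, ha, hba⟩ := hb
    exact ⟨hb, a, ha, lt_of_le_of_ne hba (hAB a ha b hb).symm⟩
  have hm₂' : ∀ b ∈ B₂, ∀ a ∈ A, b < a := by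
    intro b hb a ha
    obtain ⟨hbB, a', ha', hlt⟩ := hm₂ b hb
    have h₁ := hcross a ha a' ha' b hbB
    have h₂ := hAB a ha b hbB
    omega
  have hd₁ : B₁.Pairwise (· > ·) := hBdesc.sublist List.filter_sublist
  have hd₂ : B₂.Pairwise (· > ·) := hBdesc.sublist List.filter_sublist
  have h12 : ∀ x ∈ B₁, ∀ y ∈ B₂, x > y := by
    intro x hx y hy
    obtain ⟨-, a, ha, hlt⟩ := hm₂ y hy
    exact hlt.trans ((hm₁ x hx).2 a ha)
  have hBeq : B₁ ++ B₂ = B :=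
    List.Perm.eq_of_pairwise' (List.pairwise_append.2 ⟨hd₁, hd₂, h12⟩) hBdesc hperm
  have hsorted : ((N :: B₁) ++ A ++ B₂).Pairwise (· > ·) := by
    simp only [List.pairwise_append, List.pairwise_cons, List.mem_append, List.mem_cons]
    refine ⟨⟨⟨fun b hb => hB b (hm₁ b hb).1, hd₁⟩, hAdesc, ?_⟩, hd₂, ?_⟩
    · rintro x (rfl | hx) y hy
      · exact hA y hy
      · exact (hm₁ x hx).2 y hy
    · rintro x ((rfl | hx) | hx) y hy
      · exact hB y (hm₂ y hy).1
      · exact h12 x hx y hy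
      · exact hm₂' y hy x hx
  have heq : (N :: B₁) ++ A ++ B₂ = descList N := by
    refine List.Perm.eq_of_pairwise' hsorted (pairwise_descList N) ?_
    have h₁ : ((N :: B₁) ++ A ++ B₂).Perm (A ++ N :: B) := by
      rw [← hBeq]
      simpa using (List.perm_append_comm (l₁ := N :: B₁) (l₂ := A)).append_right B₂
    exact h₁.trans (hp.perm (isPermList_descList N) (by rw [hN, length_descList]))
  refine ⟨A.length, (N :: B₁).length, B₂.length, ?_⟩
  rw [← blockPerm_eq_of_append_eq_descList heq, ← hBeq]
  simp

lemma finite_avClass (n : ℕ) : (avClass n).Finite := by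
  refine (List.finite_toSet (descList n).permutations).subset ?_
  intro l hl
  exact List.mem_permutations.2
    (hl.2.1.perm (isPermList_descList n) (by rw [hl.1, length_descList]))

lemma exists_eq_blockPerm_of_ne_descList {n : ℕ} {l : List ℕ} (h : l ∈ avClass n)
    (hd : l ≠ descList l.length) : ∃ k m j, 1 ≤ k ∧ 1 ≤ m ∧ l = blockPerm k m j := by
  obtain ⟨k, m, j, rfl⟩ := exists_eq_blockPerm h
  rw [length_blockPerm, descList_eq_blockPerm] at hd
  refine ⟨k, m, j, ?_, ?_, rfl⟩ <;> by_contra h0 <;> apply hd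
  all_goals
    apply List.ext_getElem
    · simp [length_blockPerm]
    · intro i h₁ h₂
      rw [length_blockPerm] at h₁
      rw [getElem_blockPerm, getElem_blockPerm]
      unfold blockVal
      split_ifs <;> omega

lemma ncard_involvingClass_blockPerm {k m j : ℕ} (hk : 1 ≤ k) (hm : 1 ≤ m) (n : ℕ) :
    (involvingClass (blockPerm k m j) n).ncard =
      {p : ℕ × ℕ × ℕ | p.1 + p.2.1 + p.2.2 + (k + m + j) = n}.ncard := by
  symm
  refine Set.ncard_congr (fun p _ => blockPerm (k + p.1) (m + p.2.1) (j + p.2.2)) ?_ ?_ ?_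
  · rintro ⟨a, b, c⟩ (hn : a + b + c + (k + m + j) = n)
    refine ⟨?_, (involves_blockPerm_iff hk hm).2 ⟨by simp, by simp, by simp⟩⟩
    rw [show n = k + a + (m + b) + (j + c) by omega]
    exact blockPerm_mem_avClass _ _ _
  · rintro ⟨a, b, c⟩ ⟨a', b', c'⟩ - - heq
    dsimp only at heq
    have h₁ := involves_refl (blockPerm (k + a) (m + b) (j + c))
    have h₂ := h₁
    rw (occs := .pos [2]) [heq] at h₁
    rw (occs := .pos [1]) [heq] at h₂
    rw [involves_blockPerm_iff (by omega) (by omega)] at h₁ h₂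
    simp only [Prod.mk.injEq]
    omega
  · rintro l ⟨hl, hinv⟩
    have hlen := hl.1
    obtain ⟨K, M, J, rfl⟩ := exists_eq_blockPerm hl
    rw [length_blockPerm] at hlen
    obtain ⟨h₁, h₂, h₃⟩ := (involves_blockPerm_iff hk hm).1 hinv
    refine ⟨(K - k, M - m, J - j), ?_, ?_⟩
    · simp only [Set.mem_ofPred_eq]
      omega
    · simp only [Nat.add_sub_cancel' h₁, Nat.add_sub_cancel' h₂, Nat.add_sub_cancel' h₃]

lemma card_avoiding_add_ncard_involvingClass (π : List ℕ) (n : ℕ) :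
    Nat.card {l : List ℕ // l.length = n ∧ IsPermList l ∧
      ¬ Involves [3, 1, 2] l ∧ ¬ Involves [1, 2, 3] l ∧ ¬ Involves π l} +
      (involvingClass π n).ncard = (avClass n).ncard := by
  have hsub : involvingClass π n ⊆ avClass n := Set.sep_subset _ _
  rw [← Set.ncard_sdiff_add_ncard_of_subset hsub (finite_avClass n)]
  congr 1
  rw [← Nat.card_coe_set_eq]
  refine Nat.card_congr (Equiv.subtypeEquivRight fun l => ?_)
  simp only [involvingClass, avClass, Set.mem_sdiff, Set.mem_ofPred_eq]
  tauto

lemma card_avoiding_eq_iff (π τ : List ℕ) (n : ℕ) :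
    Nat.card {l : List ℕ // l.length = n ∧ IsPermList l ∧
      ¬ Involves [3, 1, 2] l ∧ ¬ Involves [1, 2, 3] l ∧ ¬ Involves π l} =
    Nat.card {l : List ℕ // l.length = n ∧ IsPermList l ∧
      ¬ Involves [3, 1, 2] l ∧ ¬ Involves [1, 2, 3] l ∧ ¬ Involves τ l} ↔
    (involvingClass π n).ncard = (involvingClass τ n).ncard := by
  have h₁ := card_avoiding_add_ncard_involvingClass π n
  have h₂ := card_avoiding_add_ncard_involvingClass τ n
  omega

lemma involvingClass_self_nonempty {π : List ℕ} {n : ℕ} (h : π ∈ avClass n) :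
    (involvingClass π n).Nonempty := ⟨π, h, involves_refl π⟩

lemma involvingClass_eq_empty {π : List ℕ} {n : ℕ} (h : n < π.length) :
    involvingClass π n = ∅ := by
  rw [Set.eq_empty_iff_forall_notMem]
  rintro l ⟨hl, hinv⟩
  have := hinv.length_le
  rw [hl.1] at this
  omega

lemma length_le_of_ncard_involvingClass_eq {π τ : List ℕ} (hπ : π ∈ avClass π.length)
    (h : ∀ n, (involvingClass π n).ncard = (involvingClass τ n).ncard) :
    τ.length ≤ π.length := by
  by_contra hlt
  have h₁ := h π.length
  have hfin : (involvingClass π π.length).Finite :=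
    (finite_avClass _).subset (Set.sep_subset _ _)
  rw [involvingClass_eq_empty (π := τ) (by omega), Set.ncard_empty,
    Set.ncard_eq_zero hfin] at h₁
  exact (involvingClass_self_nonempty hπ).ne_empty h₁

lemma involvingClass_descList {s n : ℕ} (h : 2 * s ≤ n) :
    involvingClass (descList s) n = avClass n := by
  refine (Set.sep_subset _ _).antisymm fun l hl => ⟨hl, ?_⟩
  have hlen := hl.1
  obtain ⟨K, M, J, rfl⟩ := exists_eq_blockPerm hl
  rw [length_blockPerm] at hlen
  exact involves_descList_blockPerm (by omega)

lemma eq_descList_of_ncard_involvingClass_eq {π τ : List ℕ} (hπ : π = descList π.length)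
    (hτ : τ ∈ avClass τ.length)
    (h : ∀ n, (involvingClass π n).ncard = (involvingClass τ n).ncard) :
    τ = descList τ.length := by
  by_contra hd
  obtain ⟨k, m, j, hk, hm, rfl⟩ := exists_eq_blockPerm_of_ne_descList hτ hd
  have h₁ := h (2 * π.length)
  rw [hπ, length_descList, involvingClass_descList le_rfl] at h₁
  have h₂ := Set.eq_of_subset_of_ncard_le (Set.sep_subset _ _) h₁.le (finite_avClass _)
  have hmem : descList (2 * π.length) ∈ avClass (2 * π.length) := by
    simpa [descList_eq_blockPerm] using blockPerm_mem_avClass 0 (2 * π.length) 0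
  rw [← h₂] at hmem
  have hinv := hmem.2
  rw [descList_eq_blockPerm, involves_blockPerm_iff hk hm] at hinv
  omega

/-- In `C = Av(312, 123)`, two nonempty `π, τ ∈ C` give Wilf-equivalent principal subclasses
iff they have the same size and either both or neither is strictly decreasing. -/
theorem wilf_av312_123 (π τ : List ℕ) (hπ : IsPermList π) (hτ : IsPermList τ)
    (hπne : π ≠ []) (hτne : τ ≠ [])
    (hπC : ¬ Involves [3, 1, 2] π ∧ ¬ Involves [1, 2, 3] π)
    (hτC : ¬ Involves [3, 1, 2] τ ∧ ¬ Involves [1, 2, 3] τ) :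
    (∀ n : ℕ,
        Nat.card {l : List ℕ // l.length = n ∧ IsPermList l ∧
          ¬ Involves [3, 1, 2] l ∧ ¬ Involves [1, 2, 3] l ∧ ¬ Involves π l} =
        Nat.card {l : List ℕ // l.length = n ∧ IsPermList l ∧
          ¬ Involves [3, 1, 2] l ∧ ¬ Involves [1, 2, 3] l ∧ ¬ Involves τ l}) ↔
      (π.length = τ.length ∧ (π = descList π.length ↔ τ = descList τ.length)) := by
  have hπ' : π ∈ avClass π.length := ⟨rfl, hπ, hπC⟩
  have hτ' : τ ∈ avClass τ.length := ⟨rfl, hτ, hτC⟩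
  simp only [card_avoiding_eq_iff]
  constructor
  · intro h
    have h' := fun n => (h n).symm
    exact ⟨(length_le_of_ncard_involvingClass_eq hτ' h').antisymm
      (length_le_of_ncard_involvingClass_eq hπ' h),
      fun hd => eq_descList_of_ncard_involvingClass_eq hd hτ' h,
      fun hd => eq_descList_of_ncard_involvingClass_eq hd hπ' h'⟩
  · rintro ⟨hlen, hdesc⟩ n
    by_cases hd : π = descList π.length
    · rw [hd, hdesc.1 hd, hlen]
    · obtain ⟨k, m, j, hk, hm, rfl⟩ := exists_eq_blockPerm_of_ne_descList hπ' hd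
      obtain ⟨k', m', j', hk', hm', rfl⟩ :=
        exists_eq_blockPerm_of_ne_descList hτ' (fun h => hd (hdesc.2 h))
      rw [length_blockPerm, length_blockPerm] at hlen
      rw [ncard_involvingClass_blockPerm hk hm, ncard_involvingClass_blockPerm hk' hm', hlen]
end
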